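/- arXiv:1003.3922 — 2 statements merged into one kernel-verified Lean document; each statement's English description precedes it below -/
import Mathlib

section
/- Fix integers N ≥ 1 and 1 ≤ M ≤ N, an integer K ≥ 1, nondecreasing K-tuples j = (j_1 ≤ … ≤ j_K) and m = (m_1 ≤ … ≤ m_K) of natural numbers, and integers 0 ≤ α ≤ γ ≤ N and 0 ≤ β ≤ δ ≤ N. Then the cardinality of the finite set of integers I_a ∩ {k : 1 ≤ k, k ≤ α−N+M, k ≤ N−β} is at most the cardinality of I_b ∩ {l : 1 ≤ l, l ≤ γ−N+M, l ≤ N−δ}. (Inequality (6.14) in the proof of Proposition 5.1, establishing the attractiveness condition (C+) for the mass-migration rates of Model III, which equal λ for each flock size k with α−k ≥ N−M and β+k ≤ N.) -/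
/-- **Inequality (6.14) in the proof of Proposition 5.1 (condition (C+)).** With
`I_a = ⋃_i (δ−β+j_i, m_i]` and `I_b = ⋃_i (j_i, γ−α+m_i]` for nondecreasing tuples
`j`, `m` and `0 ≤ α ≤ γ ≤ N`, `0 ≤ β ≤ δ ≤ N`, `1 ≤ M ≤ N`, the number of flock
sizes `k` in `I_a` with `1 ≤ k ≤ α−N+M` and `k ≤ N−β` is at most the number of
`l` in `I_b` with `1 ≤ l ≤ γ−N+M` and `l ≤ N−δ`. -/
theorem mass_migration_attractiveness_Cplus
    (N M : ℤ) (hN : 1 ≤ N) (hM1 : 1 ≤ M) (hMN : M ≤ N)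
    (K : ℕ) (hK : 1 ≤ K)
    (j m : Fin K → ℕ) (hj : Monotone j) (hm : Monotone m)
    (α β γ δ : ℤ) (hα0 : 0 ≤ α) (hαγ : α ≤ γ) (hγN : γ ≤ N)
    (hβ0 : 0 ≤ β) (hβδ : β ≤ δ) (hδN : δ ≤ N) :
    ((Finset.univ.biUnion fun i : Fin K =>
        Finset.Ioc (δ - β + (j i : ℤ)) (m i : ℤ)) ∩
      Finset.Icc 1 (min (α - N + M) (N - β))).card ≤
    ((Finset.univ.biUnion fun i : Fin K =>
        Finset.Ioc ((j i : ℤ)) (γ - α + (m i : ℤ))) ∩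
      Finset.Icc 1 (min (γ - N + M) (N - δ))).card := by
  apply Finset.card_le_card_of_injOn (fun k => k - (δ - β))
  · intro k hk
    simp only [Finset.coe_inter, Set.mem_inter_iff, Finset.mem_coe, Finset.mem_biUnion,
      Finset.mem_univ, true_and, Finset.mem_Ioc, Finset.mem_Icc, Finset.mem_inter,
      le_min_iff] at hk ⊢
    obtain ⟨⟨i, h1, h2⟩, h3, h4, h5⟩ := hk
    exact ⟨⟨i, by omega, by omega⟩, by omega, by omega, by omega⟩
  · intro x _ y _ h
    simpa using h
end

section
/- Fix integers N ≥ 1 and 1 ≤ M ≤ N, an integer K ≥ 1, nondecreasing K-tuples h = (h_1 ≤ … ≤ h_K) and m = (m_1 ≤ … ≤ m_K) of natural numbers, and integers 0 ≤ α ≤ γ ≤ N and 0 ≤ β ≤ δ ≤ N. Then the cardinality of the finite set of integers I_c ∩ {l : 1 ≤ l, l ≤ γ−N+M, l ≤ N−δ} is at most the cardinality of I_d ∩ {k : 1 ≤ k, k ≤ α−N+M, k ≤ N−β}. (Inequality (6.15) in the proof of Proposition 5.1, establishing the attractiveness condition (C−) for the mass-migration rates of Model III, which equal λ for each flock size k with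 α−k ≥ N−M and β+k ≤ N.) -/
/-- **Inequality (6.15) in the proof of Proposition 5.1 (condition (C−)).** With
`I_c = ⋃_i (γ−α+h_i, m_i]` and `I_d = ⋃_i (h_i, δ−β+m_i]` for nondecreasing tuples
`h`, `m` and `0 ≤ α ≤ γ ≤ N`, `0 ≤ β ≤ δ ≤ N`, `1 ≤ M ≤ N`, the number of flock
sizes `l` in `I_c` with `1 ≤ l ≤ γ−N+M` and `l ≤ N−δ` is at most the number of
`k` in `I_d` with `1 ≤ k ≤ α−N+M` and `k ≤ N−β`. -/
theorem mass_migration_attractiveness_Cminus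
    (N M : ℤ) (hN : 1 ≤ N) (hM1 : 1 ≤ M) (hMN : M ≤ N)
    (K : ℕ) (hK : 1 ≤ K)
    (h m : Fin K → ℕ) (hh : Monotone h) (hm : Monotone m)
    (α β γ δ : ℤ) (hα0 : 0 ≤ α) (hαγ : α ≤ γ) (hγN : γ ≤ N)
    (hβ0 : 0 ≤ β) (hβδ : β ≤ δ) (hδN : δ ≤ N) :
    ((Finset.univ.biUnion fun i : Fin K =>
        Finset.Ioc (γ - α + (h i : ℤ)) (m i : ℤ)) ∩
      Finset.Icc 1 (min (γ - N + M) (N - δ))).card ≤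
    ((Finset.univ.biUnion fun i : Fin K =>
        Finset.Ioc ((h i : ℤ)) (δ - β + (m i : ℤ))) ∩
      Finset.Icc 1 (min (α - N + M) (N - β))).card := by
  apply Finset.card_le_card_of_injOn (fun l => l - (γ - α))
  · intro l hl
    simp only [Finset.coe_inter, Set.mem_inter_iff, Finset.mem_coe, Finset.mem_inter,
      Finset.mem_biUnion, Finset.mem_univ, true_and, Finset.mem_Ioc, Finset.mem_Icc,
      le_min_iff] at hl ⊢
    obtain ⟨⟨i, h1, h2⟩, h3, h4, h5⟩ := hl
    refine ⟨⟨i, ?_, ?_⟩, ?_, ?_, ?_⟩ <;> omega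
  · intro a _ b _ hab
    simpa using hab
end
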